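/- Let (u,u') and (v,v') be admissible couples and N ≥ 1. Then the family of positive real numbers ( (∏_{k=1}^N W(ℓ_k)) · V_N(ℓ)² )_{ℓ ∈ Ω_N} is summable if and only if u+u'+v+v' > 2N−3. (Equivalently: the symmetrizing measure of the N-particle chain is finite exactly when u+u'+v+v' > 2N−3.) -/

import Mathlib

/-- A couple `(u, u')` of complex numbers is *admissible* if for every integer `l`
the number `(u - l) * (u' - l)` is real and strictly positive. -/
def Admissible (u u' : ℂ) : Prop :=
  ∀ l : ℤ, ((u - l) * (u' - l)).im = 0 ∧ 0 < ((u - l) * (u' - l)).re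

/-- `W l = 1 / (Γ(u+1-l) Γ(u'+1-l) Γ(v+1+l) Γ(v'+1+l))`; for admissible couples this is
a positive real number, and we work with its real part. -/
noncomputable def W (u u' v v' : ℂ) (l : ℤ) : ℂ :=
  1 / (Complex.Gamma (u + 1 - l) * Complex.Gamma (u' + 1 - l) *
       Complex.Gamma (v + 1 + l) * Complex.Gamma (v' + 1 + l))

/-- The Vandermonde function `V_N(ℓ) = ∏_{1 ≤ i < j ≤ N} (ℓ_i - ℓ_j)`. -/
def Vand (N : ℕ) (ℓ : Fin N → ℤ) : ℤ :=
  ∏ i : Fin N, ∏ j ∈ Finset.Ioi i, (ℓ i - ℓ j)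

/-- Membership in `Ω_N = {ℓ ∈ ℤ^N : ℓ_1 > ℓ_2 > ⋯ > ℓ_N}`. -/
def inOmega {N : ℕ} (ℓ : Fin N → ℤ) : Prop :=
  ∀ i j : Fin N, i < j → ℓ j < ℓ i

open Filter Asymptotics

open scoped Nat Topology

section Gamma

theorem Complex.Gamma_add_nat (z : ℂ) (n : ℕ) (hz : ∀ j < n, z + j ≠ 0) :
    Complex.Gamma (z + n) = (∏ j ∈ Finset.range n, (z + j)) * Complex.Gamma z := by
  induction n with
  | zero => simp
  | succ n ih =>
    rw [Finset.prod_range_succ, Nat.cast_succ, ← add_assoc, Complex.Gamma_add_one _ (hz n (by simp)),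
      ih fun j hj => hz j (hj.trans n.lt_succ_self)]
    ring

theorem Complex.prod_range_add_isTheta (z : ℂ) (hz : ∀ j : ℕ, z ≠ -j) :
    (fun n : ℕ => ‖∏ j ∈ Finset.range (n + 1), (z + j)‖) =Θ[atTop]
      fun n : ℕ => (n : ℝ) ^ z.re * (n ! : ℝ) := by
  have hne : ‖Complex.Gamma z‖ ≠ 0 := norm_ne_zero_iff.2 (Complex.Gamma_ne_zero hz)
  refine isTheta_of_div_tendsto_nhds_ne_zero ?_ hne
  refine (Complex.GammaSeq_tendsto_Gamma z).norm.congr' ?_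
  filter_upwards [eventually_gt_atTop 0] with n hn
  simp [Complex.GammaSeq, Complex.norm_natCast_cpow_of_pos hn]

theorem Complex.Gamma_add_nat_add_one_isTheta (z : ℂ) (hz : ∀ j : ℕ, z ≠ -j) :
    (fun n : ℕ => ‖Complex.Gamma (z + (n + 1 : ℕ))‖) =Θ[atTop]
      fun n : ℕ => (n : ℝ) ^ z.re * (n ! : ℝ) := by
  have hne : ‖Complex.Gamma z‖ ≠ 0 := norm_ne_zero_iff.2 (Complex.Gamma_ne_zero hz)
  refine EventuallyEq.trans_isTheta (Eventually.of_forall fun n => ?_)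
    ((isTheta_const_mul_left hne).2 (Complex.prod_range_add_isTheta z hz))
  beta_reduce
  rw [Complex.Gamma_add_nat z _ fun j _ h => hz j (eq_neg_of_add_eq_zero_left h), norm_mul]
  ring

theorem Complex.Gamma_sub_nat_isTheta (z : ℂ) (hz : ∀ j : ℤ, z ≠ j) :
    (fun n : ℕ => ‖Complex.Gamma (z - n)‖) =Θ[atTop]
      fun n : ℕ => ((n : ℝ) ^ (-z.re) * (n ! : ℝ))⁻¹ := by
  have hne : ‖Complex.Gamma (z + 1)‖ ≠ 0 := norm_ne_zero_iff.2 <| Complex.Gamma_ne_zero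
    fun m h => hz (-m - 1) (by push_cast; linear_combination h)
  have hz' : ∀ j : ℕ, -z ≠ -j := fun j h => hz j (by simpa using h)
  refine EventuallyEq.trans_isTheta (Eventually.of_forall fun n => ?_)
    ((isTheta_const_mul_left hne).2 (Complex.prod_range_add_isTheta (-z) hz').inv)
  have h1 := Complex.Gamma_add_nat (z - n) (n + 1) fun j _ h =>
    hz (n - j) (by push_cast; linear_combination h)
  have h2 : ‖∏ j ∈ Finset.range (n + 1), (z - n + j)‖ =
      ‖∏ j ∈ Finset.range (n + 1), (-z + j)‖ := by
    rw [← Finset.prod_range_reflect, norm_prod, norm_prod]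
    refine Finset.prod_congr rfl fun j hj => ?_
    have hj : j ≤ n := Nat.lt_succ_iff.1 (Finset.mem_range.1 hj)
    rw [← norm_neg, Nat.add_sub_cancel, Nat.cast_sub hj]
    congr 1
    ring
  have h3 : ‖∏ j ∈ Finset.range (n + 1), (-z + j)‖ ≠ 0 := by
    refine norm_ne_zero_iff.2 (Finset.prod_ne_zero_iff.2 fun j _ h => hz j ?_)
    push_cast
    linear_combination -h
  have h4 : z - n + (n + 1 : ℕ) = z + 1 := by push_cast; ring
  rw [h4] at h1
  rw [h1, norm_mul, h2]
  field_simp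

end Gamma

section Admissible

variable {u u' v v' : ℂ}

theorem Admissible.sub_intCast (h : Admissible u u') (l : ℤ) : Admissible (u - l) (u' - l) := by
  intro m
  have := h (l + m)
  push_cast at this
  simpa only [sub_sub] using this

theorem Admissible.symm (h : Admissible u u') : Admissible u' u := by
  intro l
  simpa only [mul_comm] using h l

theorem Admissible.ne_intCast (h : Admissible u u') (l : ℤ) : u ≠ l := by
  rintro rfl
  simpa using (h l).2

theorem Admissible.real_or_conj (h : Admissible u u') :
    (u.im = 0 ∧ u'.im = 0) ∨ u' = starRingEnd ℂ u := by
  have h0 := (h 0).1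
  have h1 := (h 1).1
  simp at h0 h1
  have h2 : u'.im = -u.im := by linarith
  rw [h2] at h0
  have h3 : u.im * (u'.re - u.re) = 0 := by linarith
  rcases mul_eq_zero.1 h3 with h4 | h4
  · exact Or.inl ⟨h4, by rw [h2, h4, neg_zero]⟩
  · exact Or.inr (Complex.ext (by simp; linarith) (by simp [h2]))

theorem Admissible.Gamma_add_one_ne_zero (h : Admissible u u') : Complex.Gamma (u + 1) ≠ 0 :=
  Complex.Gamma_ne_zero fun m hm =>
    h.ne_intCast (-m - 1) (by push_cast; linear_combination hm)

theorem Admissible.im_Gamma_mul_Gamma (h : Admissible u u') :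
    (Complex.Gamma (u + 1) * Complex.Gamma (u' + 1)).im = 0 := by
  rcases h.real_or_conj with ⟨h1, h2⟩ | rfl
  · have key : ∀ z : ℂ, z.im = 0 → (Complex.Gamma (z + 1)).im = 0 := by
      intro z hz
      have hz' : z + 1 = ((z.re + 1 : ℝ) : ℂ) := Complex.ext (by simp) (by simp [hz])
      rw [hz', Complex.Gamma_ofReal, Complex.ofReal_im]
    simp [key u h1, key u' h2]
  · have : starRingEnd ℂ u + 1 = starRingEnd ℂ (u + 1) := by simp
    rw [this, Complex.Gamma_conj, Complex.mul_conj, Complex.ofReal_im]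

theorem W_eq (l : ℤ) : W u u' v v' l =
    (Complex.Gamma (u - l + 1) * Complex.Gamma (u' - l + 1) *
      (Complex.Gamma (v - (-l : ℤ) + 1) * Complex.Gamma (v' - (-l : ℤ) + 1)))⁻¹ := by
  rw [W, one_div, mul_assoc]
  push_cast
  congr 4 <;> ring_nf

theorem W_neg (l : ℤ) : W u u' v v' (-l) = W v v' u u' l := by
  rw [W_eq, W_eq, neg_neg, mul_comm]

theorem W_ne_zero (hu : Admissible u u') (hv : Admissible v v') (l : ℤ) :
    W u u' v v' l ≠ 0 := by
  rw [W_eq]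
  exact inv_ne_zero (mul_ne_zero (mul_ne_zero (hu.sub_intCast l).Gamma_add_one_ne_zero
    (hu.sub_intCast l).symm.Gamma_add_one_ne_zero)
    (mul_ne_zero (hv.sub_intCast (-l)).Gamma_add_one_ne_zero
      (hv.sub_intCast (-l)).symm.Gamma_add_one_ne_zero))

theorem abs_re_W (hu : Admissible u u') (hv : Admissible v v') (l : ℤ) :
    |(W u u' v v' l).re| = ‖W u u' v v' l‖ := by
  refine (Complex.abs_re_eq_norm).2 ?_
  have h1 := (hu.sub_intCast l).im_Gamma_mul_Gamma
  have h2 := (hv.sub_intCast (-l)).im_Gamma_mul_Gamma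
  rw [W_eq, Complex.inv_im, Complex.mul_im, h1, h2]
  simp

theorem W_isTheta (hu : Admissible u u') (hv : Admissible v v') :
    (fun n : ℕ => ‖W u u' v v' (n + 1 : ℕ)‖) =Θ[atTop]
      fun n : ℕ => (n : ℝ) ^ (-(u + u' + v + v').re - 2) := by
  have A : ∀ {z z' : ℂ}, Admissible z z' → ∀ j : ℕ, z + 1 ≠ -j := fun h j hj =>
    h.ne_intCast (-j - 1) (by push_cast; linear_combination hj)
  have H := (((Complex.Gamma_sub_nat_isTheta u hu.ne_intCast).mul
    (Complex.Gamma_sub_nat_isTheta u' hu.symm.ne_intCast)).mul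
    ((Complex.Gamma_add_nat_add_one_isTheta (v + 1) (A hv)).mul
      (Complex.Gamma_add_nat_add_one_isTheta (v' + 1) (A hv.symm)))).inv
  refine EventuallyEq.trans_isTheta (Eventually.of_forall fun n => ?_) (H.trans_eventuallyEq ?_)
  · simp only [W_eq, ← norm_mul, ← norm_inv]
    push_cast
    congr 4 <;> ring_nf
  · filter_upwards [eventually_gt_atTop 0] with n hn
    have hn' : (0 : ℝ) < n := by exact_mod_cast hn
    have hf : (n ! : ℝ) ≠ 0 := by positivity
    have : -(u + u' + v + v').re - 2 = -u.re + -u'.re + -(v.re + 1) + -(v'.re + 1) := by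
      simp only [Complex.add_re]; ring
    rw [this, Real.rpow_add hn', Real.rpow_add hn', Real.rpow_add hn', Real.rpow_neg hn'.le (v.re + 1),
      Real.rpow_neg hn'.le (v'.re + 1)]
    simp only [Complex.add_re, Complex.one_re]
    have p1 := (Real.rpow_pos_of_pos hn' (-u.re)).ne'
    have p2 := (Real.rpow_pos_of_pos hn' (-u'.re)).ne'
    have p3 := (Real.rpow_pos_of_pos hn' (v.re + 1)).ne'
    have p4 := (Real.rpow_pos_of_pos hn' (v'.re + 1)).ne'
    field_simp

theorem summable_norm_W_mul_pow_iff (hu : Admissible u u') (hv : Admissible v v') (k : ℕ) :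
    Summable (fun n : ℕ => ‖W u u' v v' n‖ * (1 + (n : ℝ)) ^ k) ↔
      (k : ℝ) - 1 < (u + u' + v + v').re := by
  rw [← summable_nat_add_iff 1]
  have h2 : (fun n : ℕ => (1 + ((n + 1 : ℕ) : ℝ))) =Θ[atTop] fun n : ℕ => (n : ℝ) := by
    refine (isTheta_of_div_tendsto_nhds_ne_zero (c := 1) ?_ one_ne_zero).symm
    have := (tendsto_const_nhds (x := (1 : ℝ))).add
      (tendsto_const_div_atTop_nhds_zero_nat (2 : ℝ))
    rw [add_zero] at this
    refine this.congr' ?_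
    filter_upwards [eventually_gt_atTop 0] with n hn
    have hn' : (n : ℝ) ≠ 0 := by positivity
    push_cast
    field_simp
    ring
  have H := (W_isTheta hu hv).mul (h2.pow k)
  rw [H.summable_iff_nat]
  have E : (fun n : ℕ => (n : ℝ) ^ (-(u + u' + v + v').re - 2) * (n : ℝ) ^ k) =ᶠ[atTop]
      fun n : ℕ => (n : ℝ) ^ (-(u + u' + v + v').re - 2 + k) := by
    filter_upwards [eventually_gt_atTop 0] with n hn
    rw [Real.rpow_add (by exact_mod_cast hn), Real.rpow_natCast]
  rw [E.isTheta.summable_iff_nat, Real.summable_nat_rpow]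
  constructor <;> intro h <;> linarith

theorem summable_int_norm_W_mul_pow (hu : Admissible u u') (hv : Admissible v v') (k : ℕ)
    (h : (k : ℝ) - 1 < (u + u' + v + v').re) :
    Summable (fun l : ℤ => ‖W u u' v v' l‖ * (1 + |(l : ℝ)|) ^ k) := by
  refine Summable.of_nat_of_neg ?_ ?_
  · simpa using (summable_norm_W_mul_pow_iff hu hv k).2 h
  · have h' : (k : ℝ) - 1 < (v + v' + u + u').re := by
      convert h using 2
      ring
    simpa [W_neg] using (summable_norm_W_mul_pow_iff hv hu k).2 h'

end Admissible

theorem Summable.prod_pi_of_nonneg {ι κ : Type*} [Fintype ι] {f : κ → ℝ} (hf0 : 0 ≤ f)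
    (hf : Summable f) : Summable (fun x : ι → κ => ∏ i, f (x i)) := by
  classical
  refine summable_of_sum_le (c := ∏ _i : ι, ∑' k, f k)
    (fun x => Finset.prod_nonneg fun i _ => hf0 _) fun s => ?_
  let t : ι → Finset κ := fun i => s.image fun x => x i
  calc ∑ x ∈ s, ∏ i, f (x i) ≤ ∑ x ∈ Fintype.piFinset t, ∏ i, f (x i) :=
        Finset.sum_le_sum_of_subset_of_nonneg
          (fun x hx => Fintype.mem_piFinset.2 fun i => Finset.mem_image_of_mem _ hx)
          fun x _ _ => Finset.prod_nonneg fun i _ => hf0 _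
    _ = ∏ i, ∑ k ∈ t i, f k := (Finset.prod_univ_sum t fun _ => f).symm
    _ ≤ ∏ _i : ι, ∑' k, f k := Finset.prod_le_prod
        (fun i _ => Finset.sum_nonneg fun k _ => hf0 k)
        fun i _ => hf.sum_le_tsum _ fun k _ => hf0 k

theorem abs_Vand_le (N : ℕ) (ℓ : Fin N → ℤ) :
    |(Vand N ℓ : ℝ)| ≤ ∏ i, (1 + |(ℓ i : ℝ)|) ^ (N - 1) := by
  have h1 : ∏ i, (1 + |(ℓ i : ℝ)|) ^ (N - 1) =
      ∏ i : Fin N, ∏ j ∈ Finset.Ioi i, (1 + |(ℓ i : ℝ)|) * (1 + |(ℓ j : ℝ)|) := by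
    have := Finset.prod_prod_Ioi_mul_eq_prod_prod_off_diag
      (fun _ i : Fin N => 1 + |(ℓ i : ℝ)|)
    rw [this]
    simp [Finset.card_compl]
  rw [h1, Vand]
  push_cast
  simp_rw [Finset.abs_prod]
  refine Finset.prod_le_prod (fun i _ => Finset.prod_nonneg fun j _ => abs_nonneg _)
    fun i _ => Finset.prod_le_prod (fun j _ => abs_nonneg _) fun j _ => ?_
  have := abs_sub (ℓ i : ℝ) (ℓ j)
  nlinarith [abs_nonneg (ℓ i : ℝ), abs_nonneg (ℓ j : ℝ)]

theorem pow_le_Vand_cons (M n : ℕ) :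
    ((n : ℤ) + 1) ^ M ≤
      Vand (M + 1) (Fin.cons ((n + M : ℕ) : ℤ) fun j : Fin M => (M : ℤ) - 1 - (j : ℕ)) := by
  rw [Vand, Fin.prod_univ_succ, Fin.prod_Ioi_zero]
  simp only [Fin.prod_Ioi_succ, Fin.cons_zero, Fin.cons_succ]
  have h1 : ((n : ℤ) + 1) ^ M ≤
      ∏ j : Fin M, (((n + M : ℕ) : ℤ) - ((M : ℤ) - 1 - (j : ℕ))) := by
    have := Finset.prod_le_prod (s := (Finset.univ : Finset (Fin M))) (f := fun _ => (n : ℤ) + 1)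
      (g := fun j : Fin M => ((n + M : ℕ) : ℤ) - ((M : ℤ) - 1 - (j : ℕ)))
      (fun _ _ => by positivity) (fun j _ => by push_cast; omega)
    simpa using this
  have h2 : (1 : ℤ) ≤ ∏ i : Fin M, ∏ j ∈ Finset.Ioi i,
      ((M : ℤ) - 1 - (i : ℕ) - ((M : ℤ) - 1 - (j : ℕ))) := by
    refine Int.add_one_le_iff.2 (Finset.prod_pos fun i _ => Finset.prod_pos fun j hj => ?_)
    have : i < j := Finset.mem_Ioi.1 hj
    omega
  exact h1.trans (le_mul_of_one_le_right (le_trans (by positivity) h1) h2)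

/-- For admissible couples `(u,u')`, `(v,v')` and `N ≥ 1`, the family
`((∏_k W(ℓ_k)) · V_N(ℓ)²)_{ℓ ∈ Ω_N}` is summable iff `u + u' + v + v' > 2N - 3`. -/
theorem summable_Mtilde_iff (u u' v v' : ℂ)
    (hu : Admissible u u') (hv : Admissible v v')
    (N : ℕ) (hN : 1 ≤ N) :
    Summable (fun ℓ : {ℓ : Fin N → ℤ // inOmega ℓ} =>
        (∏ k : Fin N, (W u u' v v' (ℓ.1 k)).re) * (Vand N ℓ.1 : ℝ) ^ 2)
      ↔ 2 * (N : ℝ) - 3 < (u + u' + v + v').re := by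
  obtain ⟨M, rfl⟩ : ∃ M, N = M + 1 := ⟨N - 1, by omega⟩
  have hcast : 2 * ((M + 1 : ℕ) : ℝ) - 3 = ((2 * M : ℕ) : ℝ) - 1 := by push_cast; ring
  rw [hcast, ← summable_abs_iff]
  simp only [abs_mul, Finset.abs_prod, abs_re_W hu hv, abs_pow]
  constructor
  · intro h
    have hmem : ∀ n : ℕ, inOmega (N := M + 1)
        (Fin.cons ((n + M : ℕ) : ℤ) fun j : Fin M => (M : ℤ) - 1 - (j : ℕ)) := by
      intro n i j hij
      induction i using Fin.cases with
      | zero =>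
        induction j using Fin.cases with
        | zero => simp at hij
        | succ j => simp only [Fin.cons_zero, Fin.cons_succ]; push_cast; omega
      | succ i =>
        induction j using Fin.cases with
        | zero => simp at hij
        | succ j =>
          have : (i : ℕ) < j := Fin.succ_lt_succ_iff.1 hij
          simp only [Fin.cons_succ]
          omega
    have hinj : Function.Injective
        (fun n : ℕ => (⟨_, hmem n⟩ : {ℓ : Fin (M + 1) → ℤ // inOmega ℓ})) := by
      intro m n hmn
      have := congrFun (congrArg Subtype.val hmn) 0
      simpa using this
    have hs := h.comp_injective hinj
    set c : ℝ := ∏ j : Fin M, ‖W u u' v v' ((M : ℤ) - 1 - (j : ℕ))‖ with hc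
    have hcpos : 0 < c := Finset.prod_pos fun j _ => norm_pos_iff.2 (W_ne_zero hu hv _)
    rw [← summable_norm_W_mul_pow_iff hu hv, ← summable_nat_add_iff M]
    refine Summable.of_nonneg_of_le (fun n => by positivity) (fun n => ?_)
      (hs.mul_left (((M : ℝ) + 1) ^ (2 * M) / c))
    simp only [Function.comp_apply, Fin.prod_univ_succ, Fin.cons_zero, Fin.cons_succ]
    rw [← hc]
    have hV : ((n : ℝ) + 1) ^ M ≤ |(Vand (M + 1)
        (Fin.cons ((n + M : ℕ) : ℤ) fun j : Fin M => (M : ℤ) - 1 - (j : ℕ)) : ℝ)| :=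
      le_trans (by exact_mod_cast pow_le_Vand_cons M n) (le_abs_self _)
    set V : ℝ := |(Vand (M + 1)
        (Fin.cons ((n + M : ℕ) : ℤ) fun j : Fin M => (M : ℤ) - 1 - (j : ℕ)) : ℝ)|
    have hbase : 1 + ((n + M : ℕ) : ℝ) ≤ ((M : ℝ) + 1) * (n + 1) := by
      push_cast
      nlinarith [mul_nonneg (Nat.cast_nonneg (α := ℝ) M) (Nat.cast_nonneg (α := ℝ) n)]
    have hpow : (1 + ((n + M : ℕ) : ℝ)) ^ (2 * M) ≤ ((M : ℝ) + 1) ^ (2 * M) * V ^ 2 := by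
      calc (1 + ((n + M : ℕ) : ℝ)) ^ (2 * M) ≤ (((M : ℝ) + 1) * (n + 1)) ^ (2 * M) := by gcongr
        _ = ((M : ℝ) + 1) ^ (2 * M) * (((n : ℝ) + 1) ^ M) ^ 2 := by
          rw [mul_pow, ← pow_mul, mul_comm M 2]
        _ ≤ _ := by gcongr
    calc ‖W u u' v v' ((n + M : ℕ) : ℤ)‖ * (1 + ((n + M : ℕ) : ℝ)) ^ (2 * M)
        ≤ ‖W u u' v v' ((n + M : ℕ) : ℤ)‖ * (((M : ℝ) + 1) ^ (2 * M) * V ^ 2) := by gcongr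
      _ = _ := by field_simp
  · intro h
    have hs := (Summable.prod_pi_of_nonneg (ι := Fin (M + 1)) (fun l => by positivity)
      (summable_int_norm_W_mul_pow hu hv (2 * M) h)).comp_injective
      (Subtype.val_injective (p := inOmega))
    refine Summable.of_nonneg_of_le (fun ℓ => by positivity) (fun ℓ => ?_) hs
    simp only [Function.comp_apply, Finset.prod_mul_distrib]
    have hV := abs_Vand_le (M + 1) ℓ.1
    rw [Nat.add_sub_cancel] at hV
    have hV2 : |(Vand (M + 1) ℓ.1 : ℝ)| ^ 2 ≤
        ∏ i, (1 + |(ℓ.1 i : ℝ)|) ^ (2 * M) := by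
      calc |(Vand (M + 1) ℓ.1 : ℝ)| ^ 2 ≤ (∏ i, (1 + |(ℓ.1 i : ℝ)|) ^ M) ^ 2 := by gcongr
        _ = _ := by simp only [← Finset.prod_pow, ← pow_mul, mul_comm M 2]
    gcongr
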